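/- Let ρ = S₀ … S_m (S_{m+1},O_{m+1},f_{m+1},i_{m+1}) … be an accepting super-tight run of Schewe(A) on a word w. Then for every k > m and every q ∈ S_k, the fine condition holds: rank(f_k) ≤ f_k(q) + 2(maxinfreach(S_k) − mininfreach({q})). -/

import Mathlib

/-!
Common definitions: Büchi automata, runs, languages, run DAGs and their ranks,
level rankings, tight rankings, the Schewe complementation construction and its
optimizations (Delay, SuccRank, RankSim, RankRestr, MaxRank).
-/

noncomputable section
open scoped Classical

/-- A (nondeterministic) Büchi automaton with alphabet `A` and state type `Q`. -/
structure BA (A : Type*) (Q : Type*) where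
  /-- transition function -/
  δ : Q → A → Set Q
  /-- initial states -/
  I : Set Q
  /-- accepting states -/
  F : Set Q

/-- Macrostates of the rank-based complement: the waiting part `wait S` and the
tight part `tight S O f i`. -/
inductive Mac (Q : Type*) where
  | wait : Set Q → Mac Q
  | tight : Set Q → Set Q → (Q → ℕ) → ℕ → Mac Q

namespace Mac

variable {Q : Type*}

/-- The `S`-component of a macrostate. -/
def S : Mac Q → Set Q
  | wait S => S
  | tight S _ _ _ => S

/-- The `O`-component of a macrostate (defaulting to `∅` on the waiting part). -/
def Oc : Mac Q → Set Q
  | wait _ => ∅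
  | tight _ O _ _ => O

/-- The ranking component of a macrostate (defaulting to `0` on the waiting part). -/
def fc : Mac Q → Q → ℕ
  | wait _ => fun _ => 0
  | tight _ _ f _ => f

/-- The `i`-component of a macrostate (defaulting to `0` on the waiting part). -/
def ic : Mac Q → ℕ
  | wait _ => 0
  | tight _ _ _ i => i

end Mac

namespace BA

variable {A : Type*} {Q : Type*}

/-- Transition function extended to sets of states. -/
def δS (M : BA A Q) (S : Set Q) (a : A) : Set Q := ⋃ q ∈ S, M.δ q a

/-- `ρ` is a run of `M` on the infinite word `w`, starting in an initial state. -/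
def IsRun (M : BA A Q) (w : ℕ → A) (ρ : ℕ → Q) : Prop :=
  ρ 0 ∈ M.I ∧ ∀ i, ρ (i + 1) ∈ M.δ (ρ i) (w i)

/-- A run is accepting iff it visits the accepting states infinitely often. -/
def Accepting (M : BA A Q) (ρ : ℕ → Q) : Prop :=
  ∀ n, ∃ i, n ≤ i ∧ ρ i ∈ M.F

/-- The ω-language of `M`. -/
def Lang (M : BA A Q) : Set (ℕ → A) :=
  {w | ∃ ρ, M.IsRun w ρ ∧ M.Accepting ρ}

/-! ### Run DAGs and ranks of their vertices -/

/-- Vertices of the run DAG of `M` over `w`: `(q, i)` is a vertex iff some run of `M`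
from `I` over `w` is at `q` at time `i`. -/
def dagV (M : BA A Q) (w : ℕ → A) : Set (Q × ℕ) :=
  {v | ∃ ρ, M.IsRun w ρ ∧ ρ v.2 = v.1}

/-- Edges of the run DAG of `M` over `w`. -/
def dagEdge (M : BA A Q) (w : ℕ → A) (u v : Q × ℕ) : Prop :=
  u ∈ M.dagV w ∧ v ∈ M.dagV w ∧ v.2 = u.2 + 1 ∧ v.1 ∈ M.δ u.1 (w u.2)

/-- `v` is reachable from `u` inside the subgraph of the run DAG induced by the
vertex set `U`. -/
def reachIn (M : BA A Q) (w : ℕ → A) (U : Set (Q × ℕ)) (u v : Q × ℕ) : Prop :=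
  u ∈ U ∧ Relation.ReflTransGen (fun x y => y ∈ U ∧ M.dagEdge w x y) u v

/-- The decreasing sequence of subgraphs `G⁰ ⊇ G¹ ⊇ …` used to assign ranks:
at an even stage `j` the *finite* vertices (those with finitely many vertices
reachable from them) are removed (getting rank `j`), at an odd stage `j` the
*endangered* vertices (those which cannot reach an accepting vertex) are removed
(getting rank `j`). -/
def dagG (M : BA A Q) (w : ℕ → A) : ℕ → Set (Q × ℕ)
  | 0 => M.dagV w
  | j + 1 =>
      if Even j then
        {v ∈ M.dagG w j | ¬ Set.Finite {v' | M.reachIn w (M.dagG w j) v v'}}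
      else
        {v ∈ M.dagG w j | ∃ v', M.reachIn w (M.dagG w j) v v' ∧ v'.1 ∈ M.F}

/-- The rank of a vertex of the run DAG of `M` over `w`: the stage at which the
vertex is removed, or `⊤` (i.e. ω) if it is never removed. -/
def dagRank (M : BA A Q) (w : ℕ → A) (v : Q × ℕ) : ℕ∞ :=
  sInf {j : ℕ∞ | ∃ n : ℕ, j = (n : ℕ∞) ∧ v ∈ M.dagG w n ∧ v ∉ M.dagG w (n + 1)}

/-! ### Simulations -/

/-- `R` is a direct simulation relation on `M`. -/
def IsDirSimRel (M : BA A Q) (R : Q → Q → Prop) : Prop :=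
  ∀ p r, R p r → (p ∈ M.F → r ∈ M.F) ∧
    ∀ a : A, ∀ p' ∈ M.δ p a, ∃ r' ∈ M.δ r a, R p' r'

/-- The (maximum) direct simulation `⊑_di` on `M`: the largest direct simulation
relation, i.e. the union of all direct simulation relations. -/
def DirSim (M : BA A Q) (p r : Q) : Prop :=
  ∃ R, M.IsDirSimRel R ∧ R p r

/-- The odd-rank simulation `⪯` on `M`: `p ⪯ r` iff for every word `w` and every
position `i` such that `(p,i)` and `(r,i)` are vertices of the run DAG of `M`
over `w`, if both ranks are (finite and) odd then `rank_w(p,i) ≤ rank_w(r,i)`. -/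
def OddRankSim (M : BA A Q) (p r : Q) : Prop :=
  ∀ w : ℕ → A, ∀ i : ℕ, (p, i) ∈ M.dagV w → (r, i) ∈ M.dagV w →
    ∀ np nr : ℕ, M.dagRank w (p, i) = (np : ℕ∞) → M.dagRank w (r, i) = (nr : ℕ∞) →
      Odd np → Odd nr → np ≤ nr

/-- The statically computed relation `⪯^R`: the smallest relation containing the
direct simulation and such that whenever for every letter `a` every state of
`δ(p,a)∖F` is related to every state of `δ(r,a)∖F`, also `p` is related to `r`. -/
inductive RatSim (M : BA A Q) : Q → Q → Prop
  | base {p r : Q} : M.DirSim p r → RatSim M p r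
  | step {p r : Q} :
      (∀ a : A, ∀ x ∈ M.δ p a \ M.F, ∀ y ∈ M.δ r a \ M.F, RatSim M x y) →
      RatSim M p r

/-! ### Level rankings and tightness -/

variable [Fintype Q]

/-- The rank of a ranking `f`, i.e. `max {f q | q : Q}`. -/
def rankOf (f : Q → ℕ) : ℕ := Finset.univ.sup f

/-- `f` is a level ranking for `M`: it is bounded by `2n` and assigns even ranks to
accepting states. -/
def IsLevelRanking (M : BA A Q) (f : Q → ℕ) : Prop :=
  (∀ q, f q ≤ 2 * Fintype.card Q) ∧ ∀ q ∈ M.F, Even (f q)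

/-- `f` is an `S`-tight level ranking: its rank is odd, every odd number up to its
rank is attained on `S`, and `f` is `0` outside of `S`. -/
def IsTight (M : BA A Q) (S : Set Q) (f : Q → ℕ) : Prop :=
  M.IsLevelRanking f ∧ Odd (rankOf f) ∧
  (∀ j, Odd j → j ≤ rankOf f → ∃ s ∈ S, f s = j) ∧
  ∀ q ∉ S, f q = 0

/-- Membership of `(S, O, f, i)` in the tight part `Q₂` of the Schewe construction. -/
def InQ2 (M : BA A Q) (S O : Set Q) (f : Q → ℕ) (i : ℕ) : Prop :=
  M.IsTight S f ∧ O ⊆ S ∩ {q | f q = i} ∧ Even i ∧ i + 2 ≤ 2 * Fintype.card Q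

/-- The `δ₃` transition relation of the Schewe construction (on the raw components). -/
def Delta3 (M : BA A Q) (S O : Set Q) (f : Q → ℕ) (i : ℕ) (a : A)
    (S' O' : Set Q) (f' : Q → ℕ) (i' : ℕ) : Prop :=
  S' = M.δS S a ∧ (∀ q ∈ S, ∀ q' ∈ M.δ q a, f' q' ≤ f q) ∧
  rankOf f' = rankOf f ∧
  ((O = ∅ ∧ i' = (i + 2) % (rankOf f' + 1) ∧ O' = {q | f' q = i'}) ∨
   (O ≠ ∅ ∧ i' = i ∧ O' = M.δS O a ∩ {q | f' q = i'}))

/-! ### The Schewe construction -/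

/-- The transition function of `Schewe(M)`. -/
def scheweDelta (M : BA A Q) : Mac Q → A → Set (Mac Q)
  | .wait S, a =>
      {Mac.wait (M.δS S a)} ∪
      {m | ∃ f, m = Mac.tight (M.δS S a) ∅ f 0 ∧ M.InQ2 (M.δS S a) ∅ f 0}
  | .tight S O f i, a =>
      {m | ∃ S' O' f' i', m = Mac.tight S' O' f' i' ∧ M.InQ2 S' O' f' i' ∧
           M.Delta3 S O f i a S' O' f' i'}

/-- The accepting macrostates of `Schewe(M)`: the empty waiting macrostate, and the
tight macrostates with empty `O`-component. -/
def scheweAccept (M : BA A Q) : Set (Mac Q) :=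
  {Mac.wait (∅ : Set Q)} ∪ {m | ∃ S f i, m = Mac.tight S ∅ f i ∧ M.InQ2 S ∅ f i}

/-- The Schewe complement automaton `Schewe(M)`. -/
def schewe (M : BA A Q) : BA A (Mac Q) :=
  ⟨M.scheweDelta, {Mac.wait M.I}, M.scheweAccept⟩

/-- The run `ρ` of the complement construction moves from the waiting part to the
tight part at position `m`. -/
def SwitchesAt (ρ : ℕ → Mac Q) (m : ℕ) : Prop :=
  (∀ k ≤ m, ∃ S, ρ k = Mac.wait S) ∧ ∀ k, m < k → ∃ S O f i, ρ k = Mac.tight S O f i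

/-- A run of the complement construction (switching to the tight part at `m`) is
super-tight if in the tight part its rankings coincide with the ranks of the
corresponding vertices of the run DAG of `M` over `w`. -/
def SuperTight (M : BA A Q) (w : ℕ → A) (ρ : ℕ → Mac Q) (m : ℕ) : Prop :=
  ∀ k, m < k → ∀ q ∈ (ρ k).S, (((ρ k).fc q : ℕ∞)) = M.dagRank w (q, k)

/-! ### Tight cores and trunks -/

/-- `C` is a tight core of the ranking `f`: `f(C) = {1, 3, …, rank f}` and `f` is
injective on `C`. -/
def TightCore (f : Q → ℕ) (C : Set Q) : Prop :=
  f '' C = {j | Odd j ∧ j ≤ rankOf f} ∧ Set.InjOn f C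

/-- `τ` is a trunk of the run `ρ` (switching at `m`): for every `k > m`, `τ k` is a
tight core of the macrostate `ρ k` and there is a bijection `θ : τ k → τ (k+1)`
respecting the transition function. -/
def IsTrunk (M : BA A Q) (w : ℕ → A) (ρ : ℕ → Mac Q) (m : ℕ) (τ : ℕ → Set Q) : Prop :=
  ∀ k, m < k → τ k ⊆ (ρ k).S ∧ TightCore ((ρ k).fc) (τ k) ∧
    ∃ θ : Q → Q, Set.BijOn θ (τ k) (τ (k + 1)) ∧ ∀ q ∈ τ k, θ q ∈ M.δ q (w k)

/-! ### The Delay optimization -/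

/-- Iterated (deterministic) successor of a set of states along a finite word. -/
def dSteps (M : BA A Q) : List A → Set Q → Set Q
  | [], S => S
  | a :: u, S => M.dSteps u (M.δS S a)

/-- The `δ₁`-transition `S →a δ(S,a)` closes a cycle in the waiting part, i.e. `S` is
reachable from `δ(S,a)` in the deterministic subset automaton. -/
def ClosesCycle (M : BA A Q) (S : Set Q) (a : A) : Prop :=
  ∃ u : List A, M.dSteps u (M.δS S a) = S

/-- The transition function of `Delay(M)`: the waiting-to-tight transitions are only
kept when the corresponding waiting transition closes a cycle. -/
def delayDelta (M : BA A Q) : Mac Q → A → Set (Mac Q)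
  | .wait S, a =>
      {Mac.wait (M.δS S a)} ∪
      {m | M.ClosesCycle S a ∧
           ∃ f, m = Mac.tight (M.δS S a) ∅ f 0 ∧ M.InQ2 (M.δS S a) ∅ f 0}
  | .tight S O f i, a => M.scheweDelta (Mac.tight S O f i) a

/-- The `Delay(M)` automaton. -/
def delay (M : BA A Q) : BA A (Mac Q) :=
  ⟨M.delayDelta, {Mac.wait M.I}, M.scheweAccept⟩

/-! ### The SuccRank optimization -/

/-- Iterated successor of a set of states along an infinite word. -/
def dIter (M : BA A Q) (w : ℕ → A) (S : Set Q) : ℕ → Set Q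
  | 0 => S
  | n + 1 => M.δS (M.dIter w S n) (w n)

/-- `infreach S`: the sets of states occurring infinitely often on some infinite path
of the deterministic subset automaton starting in `S` (equivalently, the union of
all strongly connected components reachable from `S`). -/
def infreach (M : BA A Q) (S : Set Q) : Set (Set Q) :=
  {R | ∃ w : ℕ → A, ∀ m : ℕ, ∃ n, m ≤ n ∧ M.dIter w S n = R}

/-- `maxinfreach S = max {|R ∖ F| : R ∈ infreach S}`. -/
def maxinfreach (M : BA A Q) (S : Set Q) : ℕ :=
  sSup {n | ∃ R ∈ M.infreach S, n = (R \ M.F).ncard}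

/-- `mininfreach S = min {|R ∖ F| : R ∈ infreach S}`. -/
def mininfreach (M : BA A Q) (S : Set Q) : ℕ :=
  sInf {n | ∃ R ∈ M.infreach S, n = (R \ M.F).ncard}

/-- The coarse SuccRank condition: `rank f ≤ 2·maxinfreach S − 1`. -/
def CondCoarse (M : BA A Q) (S : Set Q) (f : Q → ℕ) : Prop :=
  (rankOf f : ℤ) ≤ 2 * (M.maxinfreach S : ℤ) - 1

/-- The fine SuccRank condition:
`rank f ≤ min {f q + 2·(maxinfreach S − mininfreach {q}) : q ∈ S}`. -/
def CondFine (M : BA A Q) (S : Set Q) (f : Q → ℕ) : Prop :=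
  ∀ q ∈ S, (rankOf f : ℤ) ≤ (f q : ℤ) + 2 * ((M.maxinfreach S : ℤ) - (M.mininfreach {q} : ℤ))

/-- `Schewe(M)` with the tight-part macrostates restricted to those satisfying `P`. -/
def restrictTight (M : BA A Q) (P : Set Q → Set Q → (Q → ℕ) → ℕ → Prop) : BA A (Mac Q) :=
  ⟨fun m a => {m' | m' ∈ M.scheweDelta m a ∧ ∀ S O f i, m' = Mac.tight S O f i → P S O f i},
   {Mac.wait M.I},
   {m | m ∈ M.scheweAccept ∧ ∀ S O f i, m = Mac.tight S O f i → P S O f i}⟩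

/-! ### The RankSim optimization -/

/-- The RankSim condition on a macrostate with components `S` and `f`, with respect to
the odd-rank simulation `⪯`: whenever `p (⪯_f)⁺ r` for `p, r ∈ S`, also `f p ≤ f r`. -/
def RankSimCond (M : BA A Q) (S : Set Q) (f : Q → ℕ) : Prop :=
  ∀ p ∈ S, ∀ r ∈ S,
    Relation.TransGen (fun x y => Odd (f x) ∧ Odd (f y) ∧ M.OddRankSim x y) p r → f p ≤ f r

/-- The RankSim' condition, using the statically computed relation `⪯^R` instead of
the odd-rank simulation. -/
def RankSimCondR (M : BA A Q) (S : Set Q) (f : Q → ℕ) : Prop :=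
  ∀ p ∈ S, ∀ r ∈ S,
    Relation.TransGen (fun x y => Odd (f x) ∧ Odd (f y) ∧ M.RatSim x y) p r → f p ≤ f r

/-! ### The RankRestr optimization -/

/-- The `RankRestr(M)` automaton: `Schewe(M)` with the tight-part transitions
restricted to those where every odd-ranked state has a successor of the same rank. -/
def rankRestr (M : BA A Q) : BA A (Mac Q) :=
  ⟨fun m a => {m' | m' ∈ M.scheweDelta m a ∧
      ∀ S O f i S' O' f' i', m = Mac.tight S O f i → m' = Mac.tight S' O' f' i' →
        ∀ q ∈ S, Odd (f q) → ∃ q' ∈ M.δ q a, f' q' = f q},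
   {Mac.wait M.I}, M.scheweAccept⟩

/-! ### The MaxRank construction -/

/-- The auxiliary transition function `η#`: the waiting-to-tight transitions of
`Delay(M)` whose targets satisfy RankSim' and SuccRank. -/
def EtaAux (M : BA A Q) (S : Set Q) (a : A) : Set (Mac Q) :=
  {m | M.ClosesCycle S a ∧
       ∃ f, m = Mac.tight (M.δS S a) ∅ f 0 ∧ M.InQ2 (M.δS S a) ∅ f 0 ∧
         M.RankSimCondR (M.δS S a) f ∧ M.CondCoarse (M.δS S a) f ∧ M.CondFine (M.δS S a) f}

/-- The order on macrostates used for `η₂`: macrostates with the same `S`, `O` and `i`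
components are compared by their rankings, pointwise. -/
def MacLE : Mac Q → Mac Q → Prop
  | Mac.wait S, Mac.wait S' => S = S'
  | Mac.tight S O f i, Mac.tight S' O' g i' => S = S' ∧ O = O' ∧ i = i' ∧ ∀ q, f q ≤ g q
  | _, _ => False

/-- `η₂`: the maximal elements of `η#` with respect to the pointwise order on rankings. -/
def eta2 (M : BA A Q) (S : Set Q) (a : A) : Set (Mac Q) :=
  {m | m ∈ M.EtaAux S a ∧ ∀ m' ∈ M.EtaAux S a, MacLE m m' → MacLE m' m}

/-- The maximal successor ranking of `(S, f)` under letter `a`: for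
`q' ∈ δ(S,a)`, with `r = min {f s : s ∈ δ⁻¹(q',a) ∩ S}`, it is `r − 1` if `r` is odd
and `q' ∈ F`, and `r` otherwise; it is `0` outside `δ(S,a)`. -/
def fmax (M : BA A Q) (S : Set Q) (f : Q → ℕ) (a : A) (q' : Q) : ℕ :=
  if q' ∈ M.δS S a then
    let r := sInf {n | ∃ s ∈ S, q' ∈ M.δ s a ∧ f s = n}
    if Odd r ∧ q' ∈ M.F then r - 1 else r
  else 0

/-- `η₃`: the (at most one) `δ₃`-successor carrying the maximal successor ranking. -/
def eta3 (M : BA A Q) (S O : Set Q) (f : Q → ℕ) (i : ℕ) (a : A) : Set (Mac Q) :=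
  {m | ∃ S' O' i', m = Mac.tight S' O' (M.fmax S f a) i' ∧
       m ∈ M.scheweDelta (Mac.tight S O f i) a}

/-- `η₄`: obtained from the `η₃`-successor `(S', P', h', i')` by decreasing the rank of
every non-accepting state of `P'` by one (defined only when `i' ≠ 0`). -/
def eta4 (M : BA A Q) (S O : Set Q) (f : Q → ℕ) (i : ℕ) (a : A) : Set (Mac Q) :=
  {m | ∃ S' P' h' i', Mac.tight S' P' h' i' ∈ M.eta3 S O f i a ∧ i' ≠ 0 ∧
       m = Mac.tight S'
         (P' ∩ {q | (if q ∈ P' ∧ q ∉ M.F then h' q - 1 else h' q) = i'})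
         (fun u => if u ∈ P' ∧ u ∉ M.F then h' u - 1 else h' u) i'}

/-- The transition function of `MaxRank(M)`. -/
def maxRankDelta (M : BA A Q) : Mac Q → A → Set (Mac Q)
  | .wait S, a => {Mac.wait (M.δS S a)} ∪ M.eta2 S a
  | .tight S O f i, a => M.eta3 S O f i a ∪ M.eta4 S O f i a

/-- The `MaxRank(M)` automaton. -/
def maxRank (M : BA A Q) : BA A (Mac Q) :=
  ⟨M.maxRankDelta, {Mac.wait M.I}, M.scheweAccept⟩

end BA

/-! ### Statement -/

open BA

theorem aux_count {A Q : Type*} [Fintype Q] (M : BA A Q) (S T : Set Q) (f : Q → ℕ) (c : ℕ)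
    (hf : M.IsTight S f) (hTS : T ⊆ S) (hT : ∀ t ∈ T, f t ≤ c) :
    rankOf f + 2 * (T \ M.F).ncard ≤ c + 2 * (S \ M.F).ncard := by
  obtain ⟨⟨-, hF⟩, ⟨a, ha⟩, hodd, -⟩ := hf
  have hsub : T \ M.F ⊆ S \ M.F := Set.diff_subset_diff_left hTS
  have hadd := Set.ncard_sdiff_add_ncard_of_subset hsub (Set.toFinite _)
  have hcard : a + 1 - (c + 1) / 2 ≤ ((S \ M.F) \ (T \ M.F)).ncard := by
    have h1 : ((fun i => 2 * i + 1) '' (Finset.Ico ((c + 1) / 2) (a + 1) : Set ℕ))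
        ⊆ f '' ((S \ M.F) \ (T \ M.F)) := by
      rintro _ ⟨i, hi, rfl⟩
      rw [Finset.coe_Ico, Set.mem_Ico] at hi
      obtain ⟨s, hs, hfs⟩ := hodd (2 * i + 1) ⟨i, rfl⟩ (by omega)
      refine ⟨s, ⟨⟨hs, fun h => ?_⟩, fun h => ?_⟩, hfs⟩
      · obtain ⟨b, hb⟩ := hF s h
        omega
      · have := hT s h.1
        omega
    have h2 := Set.ncard_le_ncard h1 (Set.toFinite _)
    have h3 := Set.ncard_image_le (f := f) (Set.toFinite ((S \ M.F) \ (T \ M.F)))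
    rw [Set.ncard_image_of_injective _ (fun x y h => by simpa using h), Set.ncard_coe_finset,
      Nat.card_Ico] at h2
    omega
  omega

theorem aux_tight {A Q : Type*} [Fintype Q] (M : BA A Q)
    (w : ℕ → A) (ρ : ℕ → Mac Q) (m : ℕ)
    (hrun : (BA.schewe M).IsRun w ρ) (hsw : BA.SwitchesAt ρ m) (k : ℕ) (hk : m < k) :
    M.IsTight (ρ k).S (ρ k).fc := by
  obtain ⟨k, rfl⟩ : ∃ j, k = j + 1 := ⟨k - 1, by omega⟩
  have h := hrun.2 k
  obtain ⟨S, O, f, i, hρ⟩ := hsw.2 _ hk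
  rcases hk' : ρ k with S' | ⟨S', O', f', i'⟩
  · rw [hk', hρ] at h
    rcases h with h | ⟨g, h, h2⟩
    · cases h
    · rw [hρ, h]
      exact h2.1
  · rw [hk', hρ] at h
    obtain ⟨_, _, _, _, h, h2, -⟩ := h
    rw [hρ, h]
    exact h2.1

theorem aux_step {A Q : Type*} [Fintype Q] (M : BA A Q)
    (w : ℕ → A) (ρ : ℕ → Mac Q) (m : ℕ)
    (hrun : (BA.schewe M).IsRun w ρ) (hsw : BA.SwitchesAt ρ m) (k : ℕ) (hk : m < k) :
    (ρ (k + 1)).S = M.δS (ρ k).S (w k) ∧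
    (∀ q ∈ (ρ k).S, ∀ q' ∈ M.δ q (w k), (ρ (k + 1)).fc q' ≤ (ρ k).fc q) ∧
    rankOf (ρ (k + 1)).fc = rankOf (ρ k).fc := by
  have h := hrun.2 k
  obtain ⟨S, O, f, i, hρ⟩ := hsw.2 _ hk
  rw [hρ] at h
  obtain ⟨S', O', f', i', h, -, h2, h3, h4, -⟩ := h
  rw [hρ, h]
  exact ⟨h2, h3, h4⟩

theorem stmt8 {A Q : Type*} [Fintype A] [Nonempty A] [Fintype Q] (M : BA A Q)
    (w : ℕ → A) (ρ : ℕ → Mac Q) (m : ℕ)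
    (hrun : (BA.schewe M).IsRun w ρ) (hacc : (BA.schewe M).Accepting ρ)
    (hsw : BA.SwitchesAt ρ m) (hst : M.SuperTight w ρ m) :
    ∀ k, m < k → ∀ q ∈ (ρ k).S,
      (BA.rankOf ((ρ k).fc) : ℤ) ≤ ((ρ k).fc q : ℤ) +
        2 * ((M.maxinfreach ((ρ k).S) : ℤ) - (M.mininfreach {q} : ℤ)) := by
  intro k hk q hq
  set u : ℕ → A := fun n => w (k + n) with hu
  have hS : ∀ n, M.dIter u (ρ k).S n = (ρ (k + n)).S := by
    intro n
    induction n with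
    | zero => rfl
    | succ n ih =>
      show M.δS (M.dIter u (ρ k).S n) (w (k + n)) = _
      rw [ih]
      exact (aux_step M w ρ m hrun hsw (k + n) (by omega)).1.symm
  have hr : ∀ n, rankOf (ρ (k + n)).fc = rankOf (ρ k).fc := by
    intro n
    induction n with
    | zero => rfl
    | succ n ih =>
      rw [← ih]
      exact (aux_step M w ρ m hrun hsw (k + n) (by omega)).2.2
  have hT : ∀ n, ∀ t ∈ M.dIter u {q} n, t ∈ (ρ (k + n)).S ∧ (ρ (k + n)).fc t ≤ (ρ k).fc q := by
    intro n
    induction n with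
    | zero =>
      intro t ht
      have : t = q := ht
      subst this
      exact ⟨hq, le_rfl⟩
    | succ n ih =>
      intro t ht
      have ht' : t ∈ M.δS (M.dIter u {q} n) (w (k + n)) := ht
      simp only [δS, Set.mem_iUnion] at ht'
      obtain ⟨p, hp, hpt⟩ := ht'
      obtain ⟨h1, h2, -⟩ := aux_step M w ρ m hrun hsw (k + n) (by omega)
      obtain ⟨hp1, hp2⟩ := ih p hp
      refine ⟨?_, (h2 p hp1 t hpt).trans hp2⟩
      show t ∈ (ρ (k + n + 1)).S
      rw [h1]
      simp only [δS, Set.mem_iUnion]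
      exact ⟨p, hp1, hpt⟩
  obtain ⟨⟨R, T⟩, hRT⟩ := Finite.exists_infinite_fiber
    (fun n : ℕ => (M.dIter u (ρ k).S n, M.dIter u {q} n))
  have hinf : ∀ N : ℕ, ∃ n, N ≤ n ∧ M.dIter u (ρ k).S n = R ∧ M.dIter u {q} n = T := by
    intro N
    obtain ⟨n, hn, hNn⟩ := (Set.infinite_coe_iff.mp hRT).exists_gt N
    exact ⟨n, hNn.le, by simpa using hn⟩
  have hR : R ∈ M.infreach (ρ k).S := ⟨u, fun N => by
    obtain ⟨n, h1, h2, -⟩ := hinf N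
    exact ⟨n, h1, h2⟩⟩
  have hT' : T ∈ M.infreach {q} := ⟨u, fun N => by
    obtain ⟨n, h1, -, h2⟩ := hinf N
    exact ⟨n, h1, h2⟩⟩
  have hmax : (R \ M.F).ncard ≤ M.maxinfreach (ρ k).S := by
    refine le_csSup ⟨Nat.card Q, ?_⟩ ⟨R, hR, rfl⟩
    rintro _ ⟨X, -, rfl⟩
    exact Set.ncard_le_card _
  have hmin : M.mininfreach {q} ≤ (T \ M.F).ncard := Nat.sInf_le ⟨T, hT', rfl⟩
  obtain ⟨n, -, hn1, hn2⟩ := hinf 0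
  have hc := aux_count M (ρ (k + n)).S T (ρ (k + n)).fc ((ρ k).fc q)
    (aux_tight M w ρ m hrun hsw (k + n) (by omega))
    (fun t ht => (hT n t (hn2 ▸ ht)).1) (fun t ht => (hT n t (hn2 ▸ ht)).2)
  rw [hr n, ← hS n, hn1] at hc
  omega
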